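/- arXiv:2312.07344 — 4 statements merged into one kernel-verified Lean document; each statement's English description precedes it below -/
import Mathlib

section
/- Let N ≥ 1, let (r,𝒔) be a partition of N and let 1 ≤ j ≤ r with s_j ≥ 2. Then the sum of the squares of the parts strictly decreases under the elementary move τ_j: writing 𝒔̃ for the parts of τ_j(r,𝒔), one has Σ_k s̃_k² ≤ (Σ_k s_k²) − 2. Consequently, any sequence of elementary moves applied to columns of height at least 2 terminates after finitely many steps. -/
open Finset

/-- `(r, s)` is a partition of `N`: the parts `s 0 ≥ s 1 ≥ … ≥ s (r-1) ≥ 1` form a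
non-increasing sequence of positive integers summing to `N` (indices are 0-based). -/
def IsPartitionOf (N r : ℕ) (s : ℕ → ℕ) : Prop :=
  (∀ i < r, 1 ≤ s i) ∧ (∀ i j, i ≤ j → j < r → s j ≤ s i) ∧ (∑ i ∈ Finset.range r, s i = N)

/-- The `j`-th elementary move `τ_j` on a Young diagram of length `r` with parts `s`
(0-based index `j`). -/
noncomputable def tau (r : ℕ) (s : ℕ → ℕ) (j : ℕ) : ℕ × (ℕ → ℕ) :=
  if s j = 1 then (r, s)
  else
    let jstar := Nat.findGreatest (fun l => s l = s j) (r - 1)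
    if s j = s (r - 1) ∨ s j = s (r - 1) + 1 then
      (r + 1, fun l => if l = jstar then s jstar - 1 else if l = r then 1 else s l)
    else
      let k := sInf {l | s l ≤ s j - 2}
      (r, fun l => if l = jstar then s jstar - 1 else if l = k then s k + 1 else s l)

/-- An elementary move at a column of height at least `2` lowers the sum of the squares of the
parts by at least `2`. -/
theorem tau_sq_sum_add_two_le {r : ℕ} {s : ℕ → ℕ} {j : ℕ}
    (hs : ∀ i j, i ≤ j → j < r → s j ≤ s i) (hj : j < r) (h2 : 2 ≤ s j) :
    (∑ k ∈ Finset.range (tau r s j).1, ((tau r s j).2 k) ^ 2) + 2 ≤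
      ∑ k ∈ Finset.range r, (s k) ^ 2 := by
  have hle : s (r - 1) ≤ s j := hs j (r - 1) (by omega) (by omega)
  have hJ : s (Nat.findGreatest (fun l => s l = s j) (r - 1)) = s j :=
    Nat.findGreatest_spec (P := fun l => s l = s j) (m := j) (by omega) rfl
  have hJr : Nat.findGreatest (fun l => s l = s j) (r - 1) < r := by
    have := Nat.findGreatest_le (P := fun l => s l = s j) (r - 1)
    omega
  unfold tau
  rw [if_neg (by omega : s j ≠ 1)]
  generalize Nat.findGreatest (fun l => s l = s j) (r - 1) = J at hJ hJr
  have hJmem : J ∈ Finset.range r := Finset.mem_range.2 hJr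
  obtain ⟨a, ha⟩ : ∃ a, s j = a + 2 := ⟨s j - 2, by omega⟩
  dsimp only
  split_ifs with hlast
  · dsimp only
    rw [Finset.sum_range_succ, ← Finset.add_sum_erase _ _ hJmem, ← Finset.add_sum_erase _ _ hJmem]
    have hrest : ∑ l ∈ (Finset.range r).erase J,
        (if l = J then s J - 1 else if l = r then 1 else s l) ^ 2 =
        ∑ l ∈ (Finset.range r).erase J, s l ^ 2 := by
      refine Finset.sum_congr rfl fun l hl => ?_
      obtain ⟨hlJ, hlr⟩ := Finset.mem_erase.1 hl
      rw [if_neg hlJ, if_neg (Finset.mem_range.1 hlr).ne]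
    rw [hrest, if_pos rfl, if_neg hJr.ne', if_pos rfl, hJ, ha, show a + 2 - 1 = a + 1 by omega]
    nlinarith
  · have hmem : r - 1 ∈ {l | s l ≤ s j - 2} := by
      change s (r - 1) ≤ s j - 2
      omega
    have hK : s (sInf {l | s l ≤ s j - 2}) ≤ s j - 2 := Nat.sInf_mem ⟨_, hmem⟩
    have hKr : sInf {l | s l ≤ s j - 2} < r := by
      have := Nat.sInf_le hmem
      omega
    generalize sInf {l | s l ≤ s j - 2} = K at hK hKr
    have hKJ : K ≠ J := by
      rintro rfl
      omega
    have hKmem : K ∈ (Finset.range r).erase J :=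
      Finset.mem_erase.2 ⟨hKJ, Finset.mem_range.2 hKr⟩
    dsimp only
    rw [← Finset.add_sum_erase _ _ hJmem, ← Finset.add_sum_erase _ _ hJmem,
      ← Finset.add_sum_erase _ _ hKmem, ← Finset.add_sum_erase _ _ hKmem]
    have hrest : ∑ l ∈ ((Finset.range r).erase J).erase K,
        (if l = J then s J - 1 else if l = K then s K + 1 else s l) ^ 2 =
        ∑ l ∈ ((Finset.range r).erase J).erase K, s l ^ 2 := by
      refine Finset.sum_congr rfl fun l hl => ?_
      obtain ⟨hlK, hl⟩ := Finset.mem_erase.1 hl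
      rw [if_neg (Finset.ne_of_mem_erase hl), if_neg hlK]
    have hKa : s K ≤ a := by omega
    rw [hrest, if_pos rfl, if_neg hKJ, if_pos rfl, hJ, ha, show a + 2 - 1 = a + 1 by omega]
    nlinarith

/-- the sum of the squares of the parts decreases by at least `2` under an
elementary move applied at a column of height at least `2`; consequently any infinite sequence
of such moves is impossible (termination). -/
theorem elementary_move_sq_sum_decreases (N : ℕ) (hN : 1 ≤ N) :
    (∀ (r : ℕ) (s : ℕ → ℕ) (j : ℕ), IsPartitionOf N r s → j < r → 2 ≤ s j →
      (∑ k ∈ Finset.range (tau r s j).1, ((tau r s j).2 k) ^ 2) + 2 ≤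
        ∑ k ∈ Finset.range r, (s k) ^ 2) ∧
    (∀ (P : ℕ → ℕ × (ℕ → ℕ)) (j : ℕ → ℕ),
      (∀ n, IsPartitionOf N (P n).1 (P n).2 ∧ j n < (P n).1 ∧ 2 ≤ (P n).2 (j n) ∧
        P (n + 1) = tau (P n).1 (P n).2 (j n)) → False) := by
  refine ⟨fun r s j hP hj h2 => tau_sq_sum_add_two_le hP.2.1 hj h2, fun P j hP => ?_⟩
  refine not_strictAnti_of_wellFoundedLT
    (fun n => ∑ k ∈ Finset.range (P n).1, ((P n).2 k) ^ 2) (strictAnti_nat_of_succ_lt fun n => ?_)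
  obtain ⟨hpart, hj, h2, hnext⟩ := hP n
  have hdrop := tau_sq_sum_add_two_le hpart.2.1 hj h2
  rw [← hnext] at hdrop
  omega
end

section
/- The operators (A_n)_{n∈ℤ\{0}} on the polynomial algebra 𝓕 satisfy the Heisenberg commutation relations: for all nonzero integers n, m, the commutator [A_n, A_m] := A_n∘A_m − A_m∘A_n equals (n/2)·id_𝓕 if m = −n, and 0 otherwise. -/
open MvPolynomial

/-- The Fock space `𝓕 = ℂ[(φ_n)_{n ≥ 1}]`: polynomials in countably many variables
`φ_n`, `n ≥ 1`. -/
abbrev FockSpace : Type := MvPolynomial ℕ+ ℂ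

/-- The Heisenberg operators on `𝓕`: for `n ≥ 1`, `A_n = (i/2)·∂_{φ_n}` and
`A_{-n} = -i·n·(multiplication by φ_n)`; `A_0 := 0` (unused). -/
noncomputable def Aop (n : ℤ) : FockSpace →ₗ[ℂ] FockSpace :=
  if h : 0 < n then
    (Complex.I / 2) • (MvPolynomial.pderiv (⟨n.toNat, by omega⟩ : ℕ+)).toLinearMap
  else if h' : n < 0 then
    (-Complex.I * ((-n : ℤ) : ℂ)) •
      LinearMap.mulLeft ℂ (MvPolynomial.X (⟨(-n).toNat, by omega⟩ : ℕ+))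
  else 0

theorem Aop_pos (p : ℕ+) :
    Aop ((p : ℕ) : ℤ) = (Complex.I / 2) • (pderiv p).toLinearMap := by
  have hp : (0 : ℤ) < ((p : ℕ) : ℤ) := by exact_mod_cast p.pos
  rw [Aop, dif_pos hp]
  rfl

theorem Aop_neg (p : ℕ+) :
    Aop (-((p : ℕ) : ℤ)) = (-Complex.I * ((p : ℕ) : ℂ)) • LinearMap.mulLeft ℂ (X p) := by
  have hp : (0 : ℤ) < ((p : ℕ) : ℤ) := by exact_mod_cast p.pos
  have hidx (h : 0 < (- -((p : ℕ) : ℤ)).toNat) : (⟨_, h⟩ : ℕ+) = p :=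
    PNat.eq (by simp)
  rw [Aop, dif_neg (by omega), dif_pos (by omega), hidx, neg_neg, Int.cast_natCast]
  rfl

theorem MvPolynomial.pderiv_comm {σ R : Type*} [CommSemiring R] (i j : σ)
    (f : MvPolynomial σ R) : pderiv i (pderiv j f) = pderiv j (pderiv i f) := by
  classical
  induction f using MvPolynomial.induction_on with
  | C a => simp
  | add f g hf hg => simp [hf, hg]
  | mul_X f k hf =>
    have hc (a b : σ) : pderiv a (Pi.single (M := fun _ => MvPolynomial σ R) b 1 k) = 0 := by
      by_cases h : k = b
      · subst h; simp
      · simp [h]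
    simp only [Derivation.leibniz, map_add, smul_eq_mul, pderiv_X, hf, hc]
    ring

theorem Aop_pos_comm_Aop_neg (p q : ℕ+) :
    Aop ((p : ℕ) : ℤ) ∘ₗ Aop (-((q : ℕ) : ℤ)) - Aop (-((q : ℕ) : ℤ)) ∘ₗ Aop ((p : ℕ) : ℤ) =
      if p = q then (((p : ℕ) : ℂ) / 2) • (LinearMap.id : FockSpace →ₗ[ℂ] FockSpace)
      else 0 := by
  have hI : C Complex.I * C Complex.I = (-1 : FockSpace) := by
    rw [← C_mul, Complex.I_mul_I]; simp
  rw [Aop_pos, Aop_neg]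
  refine LinearMap.ext fun f => ?_
  split_ifs with h
  · subst h
    simp [Derivation.leibniz, smul_eq_C_mul, div_eq_mul_inv]
    linear_combination (-((p : ℕ) : FockSpace) * C (2⁻¹ : ℂ) * f) * hI
  · simp [Derivation.leibniz, smul_eq_C_mul, pderiv_X_of_ne (Ne.symm h)]
    ring

/-- the operators `(A_n)_{n ∈ ℤ \ {0}}` satisfy the Heisenberg commutation
relations `[A_n, A_m] = (n/2)·δ_{n,-m}·id` on `𝓕`. -/
theorem heisenberg_commutation (n m : ℤ) (hn : n ≠ 0) (hm : m ≠ 0) :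
    Aop n ∘ₗ Aop m - Aop m ∘ₗ Aop n =
      if m = -n then ((n : ℂ) / 2) • (LinearMap.id : FockSpace →ₗ[ℂ] FockSpace)
      else 0 := by
  have key (k : ℤ) (hk : k ≠ 0) : ∃ p : ℕ+, k = ((p : ℕ) : ℤ) ∨ k = -((p : ℕ) : ℤ) :=
    ⟨⟨k.natAbs, Int.natAbs_pos.mpr hk⟩, Int.natAbs_eq k⟩
  obtain ⟨p, rfl | rfl⟩ := key n hn <;> obtain ⟨q, rfl | rfl⟩ := key m hm
  · have hp := p.pos
    have hq := q.pos
    rw [if_neg (by omega), Aop_pos, Aop_pos]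
    refine LinearMap.ext fun f => ?_
    simp [MvPolynomial.pderiv_comm p q f]
  · rw [Aop_pos_comm_Aop_neg]
    simp [eq_comm]
  · rw [← neg_sub, Aop_pos_comm_Aop_neg]
    by_cases h : q = p
    · subst h
      rw [if_pos rfl, if_pos (neg_neg _).symm]
      push_cast
      module
    · simp [h]
  · have hp := p.pos
    have hq := q.pos
    rw [if_neg (by omega), Aop_neg, Aop_neg]
    refine LinearMap.ext fun f => ?_
    simp [smul_eq_C_mul]
    ring
end

section
/- The Sugawara operators satisfy the Virasoro commutation relations with central charge c_L = 1 + 6Q²: for every α ∈ ℂ and all integers n, m, on the polynomial algebra 𝓕 one has [L_n^{0,α}, L_m^{0,α}] = (n−m)·L_{n+m}^{0,α} + (c_L/12)·(n³−n)·δ_{n,−m}·id_𝓕, where the commutator is L_n^{0,α}∘L_m^{0,α} − L_m^{0,α}∘L_n^{0,α} and δ_{n,−m} equals 1 if m = −n and 0 otherwise. -/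
open MvPolynomial

/-- The Sugawara (Feigin–Fuchs) operators on `𝓕`, with background charge parameter `Q`:
`L_n^{0,α} = i(α - (n+1)Q)·A_n + Σ_{m ∉ {0,n}} A_{n-m} A_m` for `n ≠ 0`, and
`L_0^{0,α} = Δ_α·id + 2·Σ_{m ≥ 1} A_{-m} A_m`, where `Δ_α = (α/2)(Q - α/2)`.
The (locally finite) sums are interpreted as `finsum`s. -/
noncomputable def Lop (Q : ℝ) (α : ℂ) (n : ℤ) : FockSpace → FockSpace :=
  if n = 0 then
    fun p => ((α / 2) * ((Q : ℂ) - α / 2)) • p +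
      (2 : ℂ) • ∑ᶠ m : ℕ+, Aop (-((m : ℕ) : ℤ)) (Aop ((m : ℕ) : ℤ) p)
  else
    fun p => (Complex.I * (α - ((n : ℂ) + 1) * (Q : ℂ))) • Aop n p +
      ∑ᶠ m : ℤ, if m = 0 ∨ m = n then 0 else Aop (n - m) (Aop m p)

lemma Aop_zero : Aop 0 = 0 := by simp [Aop]

lemma Aop_coe_pnat (k : ℕ+) (p : FockSpace) :
    Aop ((k : ℕ) : ℤ) p = (Complex.I / 2) • pderiv k p := by
  have hk : (0 : ℤ) < ((k : ℕ) : ℤ) := by exact_mod_cast k.pos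
  simp only [Aop, dif_pos hk]
  rfl

lemma Aop_neg_coe_pnat (k : ℕ+) (p : FockSpace) :
    Aop (-((k : ℕ) : ℤ)) p = (-Complex.I * (k : ℕ)) • (X k * p) := by
  have hk : (0 : ℤ) < ((k : ℕ) : ℤ) := by exact_mod_cast k.pos
  have hcast : (((- -((k : ℕ) : ℤ) : ℤ)) : ℂ) = (k : ℕ) := by push_cast; ring
  have hidx : ∀ h, (⟨(- -((k : ℕ) : ℤ)).toNat, h⟩ : ℕ+) = k := fun h => by
    apply PNat.eq
    simp only [PNat.mk_coe]
    omega
  simp only [Aop, dif_neg (show ¬ 0 < -((k : ℕ) : ℤ) by omega),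
    dif_pos (show -((k : ℕ) : ℤ) < 0 by omega), hidx, hcast]
  rfl

lemma exists_pnat_eq {n : ℤ} (h : 0 < n) : ∃ k : ℕ+, ((k : ℕ) : ℤ) = n :=
  ⟨⟨n.toNat, by omega⟩, by simp only [PNat.mk_coe]; omega⟩

lemma pderiv_pderiv_comm (j k : ℕ+) (p : FockSpace) :
    pderiv j (pderiv k p) = pderiv k (pderiv j p) := by
  classical
  have h : ⁅(pderiv j : Derivation ℂ FockSpace FockSpace),
      (pderiv k : Derivation ℂ FockSpace FockSpace)⁆ = 0 := by
    refine derivation_ext fun i => ?_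
    simp only [Derivation.commutator_apply, pderiv_X, Pi.single_apply, Derivation.coe_zero,
      Pi.zero_apply]
    split_ifs <;> simp
  have := congrArg (fun D : Derivation ℂ FockSpace FockSpace => D p) h
  simpa [Derivation.commutator_apply, sub_eq_zero] using this

lemma int_cases_pnat (n : ℤ) :
    n = 0 ∨ (∃ k : ℕ+, n = ((k : ℕ) : ℤ)) ∨ ∃ k : ℕ+, n = -((k : ℕ) : ℤ) := by
  rcases lt_trichotomy n 0 with h | h | h
  · obtain ⟨k, hk⟩ := exists_pnat_eq (neg_pos.mpr h)
    exact Or.inr (Or.inr ⟨k, by omega⟩)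
  · exact Or.inl h
  · obtain ⟨k, hk⟩ := exists_pnat_eq h
    exact Or.inr (Or.inl ⟨k, hk.symm⟩)

/-- The Heisenberg relations `[A_n, A_m] = (n/2) δ_{n,-m}`, applied to a vector. -/
lemma Aop_Aop_comm (n m : ℤ) (p : FockSpace) :
    Aop n (Aop m p) = Aop m (Aop n p) + (if n + m = 0 then (n : ℂ) / 2 else 0) • p := by
  have key : ∀ j k : ℕ+, Aop ((j : ℕ) : ℤ) (Aop (-((k : ℕ) : ℤ)) p) =
      Aop (-((k : ℕ) : ℤ)) (Aop ((j : ℕ) : ℤ) p) +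
        (if j = k then ((j : ℕ) : ℂ) / 2 else 0) • p := by
    intro j k
    simp only [Aop_coe_pnat, Aop_neg_coe_pnat, map_smul, pderiv_mul, smul_add,
      smul_smul]
    by_cases h : j = k
    · subst h
      rw [pderiv_X_self, if_pos rfl, one_mul, add_comm]
      congr 2
      · ring
      · linear_combination (-(j : ℂ) / 2) * Complex.I_mul_I
    · rw [pderiv_X_of_ne (Ne.symm h), if_neg h, zero_mul, smul_zero, zero_add, zero_smul,
        add_zero, mul_comm]
  rcases int_cases_pnat n with rfl | ⟨j, rfl⟩ | ⟨j, rfl⟩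
  · simp [Aop_zero]
  all_goals rcases int_cases_pnat m with rfl | ⟨k, rfl⟩ | ⟨k, rfl⟩
  · simp [Aop_zero]
  · have hj := j.pos
    have h : ¬ (((j : ℕ) : ℤ) + ((k : ℕ) : ℤ) = 0) := by omega
    rw [if_neg h, zero_smul, add_zero]
    simp only [Aop_coe_pnat, map_smul]
    rw [pderiv_pderiv_comm]
  · rw [key]
    congr 2
    have : (((j : ℕ) : ℤ) + -((k : ℕ) : ℤ) = 0) ↔ j = k := by
      rw [← PNat.coe_inj]; omega
    simp only [this]
    simp
  · simp [Aop_zero]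
  · rw [key, add_assoc, ← add_smul]
    have : (-((j : ℕ) : ℤ) + ((k : ℕ) : ℤ) = 0) ↔ j = k := by
      rw [← PNat.coe_inj]; omega
    simp only [this]
    have hz : ((if k = j then ((k : ℕ) : ℂ) / 2 else 0) +
        if j = k then ((-((j : ℕ) : ℤ) : ℤ) : ℂ) / 2 else 0) = 0 := by
      by_cases h : j = k
      · subst h; simp; ring
      · simp [h, Ne.symm h]
    rw [hz, zero_smul, add_zero]
  · have hj := j.pos
    have h : ¬ (-((j : ℕ) : ℤ) + -((k : ℕ) : ℤ) = 0) := by omega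
    rw [if_neg h, zero_smul, add_zero]
    simp only [Aop_neg_coe_pnat, mul_smul_comm, smul_smul]
    rw [mul_left_comm (X j)]
    congr 1
    ring

lemma Aop_of_pos_one {n : ℤ} (h : 0 < n) : Aop n 1 = 0 := by
  obtain ⟨k, rfl⟩ := exists_pnat_eq h
  rw [Aop_coe_pnat, pderiv_one, smul_zero]

lemma constantCoeff_Aop_of_neg {n : ℤ} (h : n < 0) (p : FockSpace) :
    constantCoeff (Aop n p) = 0 := by
  obtain ⟨k, hk⟩ := exists_pnat_eq (neg_pos.mpr h)
  rw [← neg_neg n, ← hk, Aop_neg_coe_pnat, constantCoeff_smul, map_mul, constantCoeff_X, zero_mul,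
    smul_zero]

/-- Annihilation operators of large index kill a given polynomial. -/
lemma exists_Aop_eq_zero (p : FockSpace) : ∃ N : ℕ, ∀ k : ℤ, (N : ℤ) < k → Aop k p = 0 := by
  refine ⟨p.vars.sup (fun i => (i : ℕ)), fun k hk => ?_⟩
  obtain ⟨j, rfl⟩ := exists_pnat_eq (show 0 < k by omega)
  rw [Aop_coe_pnat, pderiv_eq_zero_of_notMem_vars, smul_zero]
  intro hmem
  have := Finset.le_sup (f := fun i : ℕ+ => (i : ℕ)) hmem
  omega

/-- The quadratic summands of the Sugawara operator of index `n`, indexed by `ℤ`. -/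
noncomputable def sugawaraTerm (n m : ℤ) : Module.End ℂ FockSpace :=
  if n = 0 then (if 0 < m then (2 : ℂ) • (Aop (-m) * Aop m) else 0)
  else if m = 0 ∨ m = n then 0 else Aop (n - m) * Aop m

lemma hasFiniteSupport_sugawaraTerm (n : ℤ) (p : FockSpace) :
    Function.HasFiniteSupport fun m => sugawaraTerm n m p := by
  obtain ⟨N, hN⟩ := exists_Aop_eq_zero p
  refine (Set.finite_Icc (-((N : ℤ) + |n|)) ((N : ℤ) + |n|)).subset fun m hm => ?_
  by_contra hcon
  apply hm
  have hn := le_abs_self n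
  have hn' := neg_abs_le n
  have : (N : ℤ) < m ∨ (m < -(N + |n|)) := by
    rw [Set.mem_Icc] at hcon; omega
  simp only [sugawaraTerm]
  rcases this with h | h
  · split_ifs <;> simp [hN m h]
  · split_ifs with h0 h1 h2
    · omega
    · simp
    · simp
    · rw [Module.End.mul_apply, Aop_Aop_comm, hN (n - m) (by omega)]
      rw [if_neg (by omega), map_zero, zero_smul, add_zero]

/-- The Sugawara operator as a linear endomorphism of the Fock space. -/
noncomputable def sugawara (Q : ℝ) (α : ℂ) (n : ℤ) : Module.End ℂ FockSpace :=
  (if n = 0 then ((α / 2) * ((Q : ℂ) - α / 2)) • (1 : Module.End ℂ FockSpace)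
    else (Complex.I * (α - ((n : ℂ) + 1) * (Q : ℂ))) • Aop n) +
  { toFun p := ∑ᶠ m : ℤ, sugawaraTerm n m p
    map_add' p q := by
      simp only [map_add]
      exact finsum_add_distrib (hasFiniteSupport_sugawaraTerm n p)
        (hasFiniteSupport_sugawaraTerm n q)
    map_smul' c p := by
      simp only [map_smul, RingHom.id_apply]
      exact (smul_finsum' c (hasFiniteSupport_sugawaraTerm n p)).symm }

lemma sugawara_apply (Q : ℝ) (α : ℂ) (n : ℤ) (p : FockSpace) :
    sugawara Q α n p = (if n = 0 then ((α / 2) * ((Q : ℂ) - α / 2)) • p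
      else (Complex.I * (α - ((n : ℂ) + 1) * (Q : ℂ))) • Aop n p) +
      ∑ᶠ m : ℤ, sugawaraTerm n m p := by
  simp only [sugawara, LinearMap.add_apply]
  split_ifs <;> rfl

lemma Lop_eq_sugawara (Q : ℝ) (α : ℂ) (n : ℤ) (p : FockSpace) :
    Lop Q α n p = sugawara Q α n p := by
  rw [sugawara_apply, Lop]
  split_ifs with hn
  · subst hn
    simp only
    congr 1
    have hinj : Function.Injective fun m : ℕ+ => ((m : ℕ) : ℤ) :=
      fun a b h => PNat.coe_injective (Nat.cast_injective h)
    rw [smul_finsum, ← finsum_mem_univ (fun m => sugawaraTerm 0 m p)]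
    rw [← finsum_mem_range (f := fun m => (2 : ℂ) • Aop (-m) (Aop m p)) hinj, finsum_mem_univ,
      finsum_mem_def]
    refine finsum_congr fun m => ?_
    by_cases hm : 0 < m
    · rw [Set.indicator_of_mem (show m ∈ Set.range fun k : ℕ+ => ((k : ℕ) : ℤ) from
        exists_pnat_eq hm)]
      simp [sugawaraTerm, hm]
    · rw [Set.indicator_of_notMem]
      · simp [sugawaraTerm, hm]
      · rintro ⟨k, rfl⟩
        exact hm (Int.natCast_pos.mpr k.pos)
  · simp only
    congr 1
    refine finsum_congr fun m => ?_
    simp only [sugawaraTerm, if_neg hn]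
    split_ifs <;> rfl

lemma sugawaraTerm_Aop_comm (n m k : ℤ) (p : FockSpace) :
    sugawaraTerm n m (Aop k p) = Aop k (sugawaraTerm n m p) +
      (if n = 0 then (if m = |k| then -(k : ℂ) else 0) else
        (if m = n + k then -(k : ℂ) / 2 else 0) + (if m = -k then -(k : ℂ) / 2 else 0)) •
        Aop (n + k) p := by
  have key : ∀ a b : ℤ, Aop a (Aop b (Aop k p)) = Aop k (Aop a (Aop b p)) +
      (if a + k = 0 then (a : ℂ) / 2 else 0) • Aop b p +
      (if b + k = 0 then (b : ℂ) / 2 else 0) • Aop a p := by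
    intro a b
    rw [Aop_Aop_comm b k, map_add, Aop_Aop_comm a k, map_smul]
  simp only [sugawaraTerm]
  by_cases hn : n = 0
  · subst hn
    simp only [if_true, zero_add]
    by_cases hm : 0 < m
    · simp only [if_pos hm, LinearMap.smul_apply, Module.End.mul_apply, key, map_smul]
      rw [add_assoc, smul_add]
      congr 1
      by_cases h1 : m = k
      · subst h1
        rw [if_pos (by omega), if_neg (by omega), if_pos (abs_of_pos hm).symm]
        push_cast
        module
      · by_cases h2 : m = -k
        · obtain rfl : k = -m := by omega
          rw [if_neg (by omega), if_pos (by omega), if_pos (by rw [abs_neg, abs_of_pos hm])]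
          push_cast
          module
        · rw [if_neg (by omega), if_neg (by omega), if_neg fun h => ?_]
          · simp
          · rcases abs_choice k with hk | hk <;> omega
    · simp only [if_neg hm, LinearMap.zero_apply, map_zero, zero_add]
      split_ifs with h
      · obtain rfl : k = 0 := by
          have := abs_nonneg k
          exact abs_eq_zero.mp (by omega)
        simp
      · simp
  · simp only [if_neg hn]
    by_cases hm : m = 0 ∨ m = n
    · simp only [if_pos hm, LinearMap.zero_apply, map_zero, zero_add]
      by_cases hk : k = 0
      · simp [hk]
      · by_cases hnk : n + k = 0
        · simp [hnk, Aop_zero]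
        · rw [if_neg (by omega), if_neg (by omega)]
          simp
    · simp only [if_neg hm, Module.End.mul_apply, key]
      rw [add_assoc, add_smul]
      congr 2
      · by_cases h : m = n + k
        · subst h
          rw [if_pos (by omega), if_pos rfl]
          push_cast
          congr 1
          ring
        · rw [if_neg (by omega), if_neg h, zero_smul, zero_smul]
      · by_cases h : m = -k
        · subst h
          rw [if_pos (by omega), if_pos rfl, sub_neg_eq_add]
          push_cast
          rfl
        · rw [if_neg (by omega), if_neg h, zero_smul, zero_smul]

lemma sugawara_Aop_comm (Q : ℝ) (α : ℂ) (n k : ℤ) (p : FockSpace) :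
    sugawara Q α n (Aop k p) = Aop k (sugawara Q α n p) - (k : ℂ) • Aop (n + k) p +
      (if n + k = 0 then Complex.I * (α - ((n : ℂ) + 1) * Q) * (n / 2) else 0) • p := by
  have hsum : ∑ᶠ m : ℤ, sugawaraTerm n m (Aop k p) =
      Aop k (∑ᶠ m : ℤ, sugawaraTerm n m p) - (k : ℂ) • Aop (n + k) p := by
    have hfin : ∀ (c : ℂ) (j : ℤ),
        Function.HasFiniteSupport fun m : ℤ => (if m = j then c else 0) • Aop (n + k) p :=
      fun c j => (Set.finite_singleton j).subset fun m hm => by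
        by_contra h
        exact hm (by simp only [if_neg (show ¬ m = j from h), zero_smul])
    have hsingle : ∀ (c : ℂ) (j : ℤ),
        ∑ᶠ m : ℤ, (if m = j then c else 0) • Aop (n + k) p = c • Aop (n + k) p := fun c j => by
      rw [finsum_eq_single _ j fun m hm => by rw [if_neg hm, zero_smul], if_pos rfl]
    have hAfin : Function.HasFiniteSupport fun m => Aop k (sugawaraTerm n m p) :=
      (hasFiniteSupport_sugawaraTerm n p).subset fun m hm h => hm (by
        simp only at h ⊢
        rw [h, map_zero])
    rw [map_finsum _ (hasFiniteSupport_sugawaraTerm n p),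
      finsum_congr fun m => sugawaraTerm_Aop_comm n m k p]
    by_cases hn : n = 0
    · simp only [if_pos hn]
      rw [finsum_add_distrib hAfin (hfin _ _), hsingle, neg_smul, sub_eq_add_neg]
    · simp only [if_neg hn, add_smul]
      have hfin₂ : Function.HasFiniteSupport fun m : ℤ =>
          (if m = n + k then -(k : ℂ) / 2 else 0) • Aop (n + k) p +
            (if m = -k then -(k : ℂ) / 2 else 0) • Aop (n + k) p := (hfin _ _).add (hfin _ _)
      rw [finsum_add_distrib hAfin hfin₂,
        finsum_add_distrib (hfin _ _) (hfin _ _), hsingle, hsingle]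
      module
  rw [sugawara_apply, sugawara_apply, hsum]
  split_ifs with hn hk hk
  · subst hn; simp; abel
  · simp; abel
  · rw [Aop_Aop_comm n k, if_pos hk, map_add, map_smul, smul_add, smul_smul]; abel
  · rw [Aop_Aop_comm n k, if_neg hk, map_add, map_smul]; simp; abel

lemma eq_zero_of_pderiv_eq_zero (p : FockSpace) (h : ∀ k, pderiv k p = 0)
    (h0 : constantCoeff p = 0) : p = 0 := by
  ext d
  rw [coeff_zero]
  by_cases hd : d = 0
  · subst hd; exact h0
  · obtain ⟨k, hk⟩ := Finsupp.ne_iff.mp hd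
    have hc := coeff_pderiv (i := k) p (d - Finsupp.single k 1)
    have hle : Finsupp.single k 1 ≤ d := by
      rw [Finsupp.single_le_iff]; exact Nat.one_le_iff_ne_zero.mpr hk
    rw [h, coeff_zero, tsub_add_cancel_of_le hle] at hc
    rcases mul_eq_zero.mp hc.symm with h1 | h1
    · exact h1
    · exact absurd h1 (Nat.cast_add_one_ne_zero _)

/-- Irreducibility of the Fock representation: an operator commuting with every `A_k` whose
vacuum expectation vanishes is zero. -/
lemma eq_zero_of_commute_Aop (T : Module.End ℂ FockSpace)
    (hT : ∀ k p, T (Aop k p) = Aop k (T p)) (h0 : constantCoeff (T 1) = 0) : T = 0 := by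
  have h1 : T 1 = 0 := by
    refine eq_zero_of_pderiv_eq_zero _ (fun k => ?_) h0
    have := hT ((k : ℕ) : ℤ) 1
    rw [Aop_coe_pnat, Aop_coe_pnat, pderiv_one, smul_zero, map_zero, eq_comm, smul_eq_zero] at this
    exact this.resolve_left (by simp)
  refine LinearMap.ext fun p => ?_
  rw [LinearMap.zero_apply]
  induction p using MvPolynomial.induction_on with
  | C a => rw [← mul_one (C a), ← smul_eq_C_mul, map_smul, h1, smul_zero]
  | add p q hp hq => rw [map_add, hp, hq, add_zero]
  | mul_X p k hp =>
    have := hT (-((k : ℕ) : ℤ)) p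
    rw [hp, map_zero, Aop_neg_coe_pnat, map_smul, smul_eq_zero] at this
    rw [mul_comm]
    exact this.resolve_left (by simp)

lemma sugawara_of_pos_one (Q : ℝ) (α : ℂ) {n : ℤ} (hn : 0 < n) : sugawara Q α n 1 = 0 := by
  rw [sugawara_apply, if_neg hn.ne', Aop_of_pos_one hn, smul_zero, zero_add]
  refine finsum_eq_zero_of_forall_eq_zero fun m => ?_
  simp only [sugawaraTerm, if_neg hn.ne']
  split_ifs with h
  · rfl
  · rw [Module.End.mul_apply]
    rcases lt_or_ge 0 m with hm | hm
    · rw [Aop_of_pos_one hm, map_zero]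
    · rw [Aop_Aop_comm, Aop_of_pos_one (by omega), if_neg (by omega)]; simp

lemma sugawara_zero_one (Q : ℝ) (α : ℂ) :
    sugawara Q α 0 1 = ((α / 2) * ((Q : ℂ) - α / 2)) • 1 := by
  rw [sugawara_apply, if_pos rfl, finsum_eq_zero_of_forall_eq_zero, add_zero]
  intro m
  simp only [sugawaraTerm, if_true]
  split_ifs with h
  · simp [Aop_of_pos_one h]
  · rfl

lemma constantCoeff_finsum_eq_zero {f : ℤ → FockSpace} (h : ∀ m, constantCoeff (f m) = 0) :
    constantCoeff (∑ᶠ m, f m) = 0 :=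
  finsum_induction (fun p => constantCoeff p = 0) (map_zero _)
    (fun p q hp hq => by rw [map_add, hp, hq, add_zero]) h

lemma constantCoeff_sugawara_of_neg (Q : ℝ) (α : ℂ) {n : ℤ} (hn : n < 0) (p : FockSpace) :
    constantCoeff (sugawara Q α n p) = 0 := by
  rw [sugawara_apply, if_neg hn.ne, map_add, constantCoeff_smul, constantCoeff_Aop_of_neg hn,
    smul_zero, zero_add]
  refine constantCoeff_finsum_eq_zero fun m => ?_
  simp only [sugawaraTerm, if_neg hn.ne]
  split_ifs with h
  · simp
  · rw [Module.End.mul_apply]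
    rcases lt_or_ge (n - m) 0 with hm | hm
    · exact constantCoeff_Aop_of_neg hm _
    · rw [Aop_Aop_comm, if_neg (by omega), zero_smul, add_zero,
        constantCoeff_Aop_of_neg (by omega)]

lemma constantCoeff_sugawara_zero (Q : ℝ) (α : ℂ) (p : FockSpace) :
    constantCoeff (sugawara Q α 0 p) = (α / 2) * ((Q : ℂ) - α / 2) * constantCoeff p := by
  rw [sugawara_apply, if_pos rfl, map_add, constantCoeff_smul, constantCoeff_finsum_eq_zero,
    add_zero, smul_eq_mul]
  intro m
  simp only [sugawaraTerm, if_true]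
  split_ifs with h
  · rw [LinearMap.smul_apply, constantCoeff_smul, Module.End.mul_apply,
      constantCoeff_Aop_of_neg (by omega), smul_zero]
  · simp

lemma constantCoeff_sugawara_one (Q : ℝ) (α : ℂ) (n : ℤ) :
    constantCoeff (sugawara Q α n 1) = if n = 0 then (α / 2) * ((Q : ℂ) - α / 2) else 0 := by
  split_ifs with h
  · rw [h, constantCoeff_sugawara_zero, map_one, mul_one]
  · rcases lt_or_gt_of_ne h with h | h
    · exact constantCoeff_sugawara_of_neg Q α h 1
    · rw [sugawara_of_pos_one Q α h, map_zero]

lemma sum_Ico_neg_mul (x : ℂ) (N : ℕ) :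
    ∑ b ∈ Finset.Ico (-(N : ℤ)) 0, (x + b) * (-b) / 2 =
      x * (N * (N + 1)) / 4 - N * (N + 1) * (2 * N + 1) / 12 := by
  induction N with
  | zero => simp
  | succ N ih =>
    have : Finset.Ico (-((N + 1 : ℕ) : ℤ)) 0 =
        insert (-((N + 1 : ℕ) : ℤ)) (Finset.Ico (-(N : ℤ)) 0) := by
      ext b; simp only [Finset.mem_Ico, Finset.mem_insert]; omega
    rw [this, Finset.sum_insert (by simp), ih]
    push_cast
    ring

lemma constantCoeff_sugawara_sugawara_one (Q : ℝ) (α : ℂ) {n m : ℤ} (hn : 0 < n) (hm : m < 0) :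
    constantCoeff (sugawara Q α n (sugawara Q α m 1)) =
      if n + m = 0 then 2 * n * ((α / 2) * ((Q : ℂ) - α / 2)) +
        (1 + 6 * (Q : ℂ) ^ 2) / 12 * ((n : ℂ) ^ 3 - n) else 0 := by
  have hA : ∀ a b : ℤ, b < 0 → constantCoeff (Aop a (Aop b 1)) =
      if a + b = 0 then (a : ℂ) / 2 else 0 := by
    intro a b hb
    rw [Aop_Aop_comm, map_add, constantCoeff_Aop_of_neg hb, constantCoeff_smul]
    simp
  have hB : constantCoeff (sugawara Q α n (Aop m 1)) =
      if n + m = 0 then Complex.I * (α - ((n : ℂ) + 1) * Q) * (n / 2) else 0 := by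
    rw [sugawara_Aop_comm, sugawara_of_pos_one Q α hn, map_zero, zero_sub, map_add, map_neg,
      constantCoeff_smul, constantCoeff_smul]
    have : constantCoeff (Aop (n + m) 1) = 0 := by
      rcases lt_trichotomy (n + m) 0 with h | h | h
      · exact constantCoeff_Aop_of_neg h _
      · simp [h, Aop_zero]
      · simp [Aop_of_pos_one h]
    simp [this]
  have hC : ∀ b, constantCoeff (sugawara Q α n (sugawaraTerm m b 1)) =
      if b ∈ Finset.Ico m 0 then
        (if n + m = 0 then ((n : ℂ) + b) * (-b) / 2 else 0) else 0 := by
    intro b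
    simp only [sugawaraTerm, if_neg hm.ne]
    by_cases hb : m < b ∧ b < 0
    · rw [if_neg (by omega), Module.End.mul_apply, sugawara_Aop_comm, map_add, map_sub,
        constantCoeff_Aop_of_neg (by omega), constantCoeff_smul, constantCoeff_smul,
        constantCoeff_Aop_of_neg hb.2, hA _ _ hb.2, if_pos (Finset.mem_Ico.mpr ⟨hb.1.le, hb.2⟩)]
      have : n + (m - b) + b = 0 ↔ n + m = 0 := by omega
      simp only [this, smul_zero, add_zero]
      by_cases h : n + m = 0
      · have h' : (m : ℂ) = -n := by
          rw [show m = -n by omega]; push_cast; ring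
        simp only [if_pos h, smul_eq_mul]
        push_cast
        rw [h']
        ring
      · simp only [if_neg h, smul_zero, sub_zero]
    · have h0 : (if b = 0 ∨ b = m then 0 else Aop (m - b) * Aop b : Module.End ℂ FockSpace) 1
          = 0 := by
        split_ifs with h
        · rfl
        · rw [Module.End.mul_apply]
          rcases lt_or_ge 0 b with h1 | h1
          · rw [Aop_of_pos_one h1, map_zero]
          · rw [Aop_Aop_comm, Aop_of_pos_one (by omega), if_neg (by omega)]; simp
      rw [h0, map_zero, map_zero]
      split_ifs with h1 h2
      · rw [Finset.mem_Ico] at h1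
        have : b = -n := by omega
        rw [this]; push_cast; ring
      · rfl
      · rfl
  have hD : constantCoeff (sugawara Q α n (∑ᶠ b, sugawaraTerm m b 1)) =
      ∑ b ∈ Finset.Ico m 0, if n + m = 0 then ((n : ℂ) + b) * (-b) / 2 else 0 := by
    have hfin := hasFiniteSupport_sugawaraTerm m 1
    have := map_finsum ((lcoeff ℂ (0 : ℕ+ →₀ ℕ)).comp (sugawara Q α n)) hfin
    simp only [LinearMap.comp_apply, lcoeff_apply, ← constantCoeff_eq] at this
    rw [this, finsum_congr hC, finsum_eq_sum_of_support_subset (s := Finset.Ico m 0)]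
    · exact Finset.sum_congr rfl fun b hb => if_pos hb
    · intro b hb
      by_contra h
      exact hb (if_neg h)
  rw [sugawara_apply Q α m, if_neg hm.ne, map_add, map_smul, map_add, constantCoeff_smul, hB, hD]
  split_ifs with h
  · obtain ⟨N, rfl⟩ := Int.eq_ofNat_of_zero_le hn.le
    obtain rfl : m = -(N : ℤ) := by omega
    rw [sum_Ico_neg_mul]
    push_cast
    simp only [smul_eq_mul]
    linear_combination ((α - (-(N : ℂ) + 1) * Q) * (α - (N + 1) * Q) * (N / 2)) * Complex.I_mul_I
  · simp

lemma sugawara_virasoro_of_le (Q : ℝ) (α : ℂ) {n m : ℤ} (hmn : m ≤ n) (p : FockSpace) :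
    sugawara Q α n (sugawara Q α m p) - sugawara Q α m (sugawara Q α n p) =
      ((n : ℂ) - (m : ℂ)) • sugawara Q α (n + m) p +
        (if n + m = 0 then ((1 + 6 * (Q : ℂ) ^ 2) / 12) * ((n : ℂ) ^ 3 - n) else 0) • p := by
  set c : ℂ := if n + m = 0 then ((1 + 6 * (Q : ℂ) ^ 2) / 12) * ((n : ℂ) ^ 3 - n) else 0 with hc
  let T : Module.End ℂ FockSpace :=
    sugawara Q α n * sugawara Q α m - sugawara Q α m * sugawara Q α n -
      ((n : ℂ) - (m : ℂ)) • sugawara Q α (n + m) - c • 1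
  have hTp : ∀ q, T q = sugawara Q α n (sugawara Q α m q) - sugawara Q α m (sugawara Q α n q) -
      ((n : ℂ) - (m : ℂ)) • sugawara Q α (n + m) q - c • q := fun q => rfl
  have hT : T = 0 := by
    refine eq_zero_of_commute_Aop T (fun k q => ?_) ?_
    · simp only [hTp, sugawara_Aop_comm, map_add, map_sub, map_smul]
      rw [show n + (m + k) = n + m + k by ring, show m + (n + k) = n + m + k by ring]
      by_cases h : n + m + k = 0
      · have hk : (k : ℂ) = -n - m := by
          rw [show k = -n - m by omega]; push_cast; ring
        simp only [if_pos h, hk]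
        push_cast
        module
      · simp only [if_neg h]
        push_cast
        module
    · rw [hTp, map_sub, map_sub, map_sub, constantCoeff_smul, constantCoeff_smul,
        map_one constantCoeff, constantCoeff_sugawara_one, hc]
      rcases lt_trichotomy m 0 with hm | hm | hm
      · rw [constantCoeff_sugawara_of_neg Q α hm]
        rcases lt_trichotomy n 0 with hn | hn | hn
        · rw [constantCoeff_sugawara_of_neg Q α hn, if_neg (by omega), if_neg (by omega)]
          simp
        · rw [hn, constantCoeff_sugawara_zero, constantCoeff_sugawara_of_neg Q α hm,
            if_neg (by omega), if_neg (by omega)]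
          simp
        · rw [constantCoeff_sugawara_sugawara_one Q α hn hm]
          split_ifs with h
          · have h' : (m : ℂ) = -n := by
              rw [show m = -n by omega]; push_cast; ring
            rw [h']
            simp only [smul_eq_mul]
            ring
          · simp
      · subst hm
        rcases hmn.eq_or_lt with hn | hn
        · simp [← hn]
        · rw [sugawara_zero_one, map_smul, sugawara_of_pos_one Q α hn, if_neg (by omega),
            if_neg (by omega)]
          simp
      · rw [sugawara_of_pos_one Q α hm, sugawara_of_pos_one Q α (hm.trans_le hmn),
          if_neg (by omega), if_neg (by omega)]
        simp
  have := hTp p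
  rw [hT, LinearMap.zero_apply, eq_comm, sub_sub, sub_eq_zero] at this
  exact this

/-- the Sugawara operators satisfy the Virasoro commutation relations with
central charge `c_L = 1 + 6Q²`:
`[L_n^{0,α}, L_m^{0,α}] = (n-m)·L_{n+m}^{0,α} + (c_L/12)(n³-n)·δ_{n,-m}·id` on `𝓕`. -/
theorem sugawara_virasoro_commutation (γ : ℝ) (hγ0 : 0 < γ) (hγ2 : γ < 2) (α : ℂ)
    (n m : ℤ) (p : FockSpace) :
    Lop (γ / 2 + 2 / γ) α n (Lop (γ / 2 + 2 / γ) α m p) -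
        Lop (γ / 2 + 2 / γ) α m (Lop (γ / 2 + 2 / γ) α n p) =
      ((n : ℂ) - (m : ℂ)) • Lop (γ / 2 + 2 / γ) α (n + m) p +
        (if m = -n then
          ((((1 : ℂ) + 6 * ((γ : ℂ) / 2 + 2 / γ) ^ 2) / 12) * ((n : ℂ) ^ 3 - n)) • p
        else 0) := by
  have h := Lop_eq_sugawara (γ / 2 + 2 / γ) α
  simp only [h]
  have hmn : m = -n ↔ n + m = 0 := by omega
  rcases le_total m n with hle | hle
  · rw [sugawara_virasoro_of_le _ α hle]
    simp only [hmn]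
    split_ifs <;> simp
  · rw [← neg_sub, sugawara_virasoro_of_le _ α hle, neg_add, ← neg_smul, ← neg_smul, neg_sub,
      add_comm m n]
    simp only [hmn]
    split_ifs with h0
    · have h' : (m : ℂ) = -n := by
        rw [hmn.mpr h0]; push_cast; ring
      rw [h']
      push_cast
      congr 2
      ring
    · simp
end

section
/- Level-two singular vector and the Kac table: for every α ∈ ℂ, (α²·L_{−2}^{0,α} + (L_{−1}^{0,α})²)(1) = 2α(α² + Qα + 1)·φ_2 = 2α(α − α_{1,2})(α − α_{2,1})·φ_2, where α_{1,2} = −2/γ and α_{2,1} = −γ/2. In particular this polynomial vanishes if and only if α ∈ {0, −γ/2, −2/γ}, and it is nonzero at the dual weights 2Q − α_{1,2} and 2Q − α_{2,1}. -/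
open MvPolynomial

/-- The level-two singular combination `(α²·L_{-2}^{0,α} + (L_{-1}^{0,α})²) 1`. -/
noncomputable def levelTwoSingular (Q : ℝ) (α : ℂ) : FockSpace :=
  α ^ 2 • Lop Q α (-2) (1 : FockSpace) + Lop Q α (-1) (Lop Q α (-1) (1 : FockSpace))

theorem Aop_natCast (n : ℕ+) (p : FockSpace) :
    Aop ((n : ℕ) : ℤ) p = (Complex.I / 2) • pderiv n p := by
  have h : 0 < ((n : ℕ) : ℤ) := by exact_mod_cast n.pos
  simp only [Aop, dif_pos h]
  rfl

theorem Aop_neg_natCast (n : ℕ+) (p : FockSpace) :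
    Aop (-((n : ℕ) : ℤ)) p = (-Complex.I * ((n : ℕ) : ℂ)) • (X n * p) := by
  have h : 0 < ((n : ℕ) : ℤ) := by exact_mod_cast n.pos
  have h₁ : ¬ 0 < -((n : ℕ) : ℤ) := by omega
  have h₂ : -((n : ℕ) : ℤ) < 0 := by omega
  simp only [Aop, dif_neg h₁, dif_pos h₂, neg_neg]
  rfl

theorem exists_pnat_cast_eq {a : ℤ} (ha : 0 < a) : ∃ n : ℕ+, a = ((n : ℕ) : ℤ) :=
  ⟨⟨a.toNat, by omega⟩, by simp [ha.le]⟩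

theorem Aop_one_of_pos {a : ℤ} (ha : 0 < a) : Aop a (1 : FockSpace) = 0 := by
  obtain ⟨n, rfl⟩ := exists_pnat_cast_eq ha
  simp [Aop_natCast]

theorem Aop_X_of_ne {a : ℤ} (ha : 0 < a) {k : ℕ+} (hk : a ≠ ((k : ℕ) : ℤ)) :
    Aop a (X k : FockSpace) = 0 := by
  obtain ⟨n, rfl⟩ := exists_pnat_cast_eq ha
  have : k ≠ n := by rintro rfl; exact hk rfl
  simp [Aop_natCast, pderiv_X_of_ne this]

/-- An annihilation operator commutes with every creation operator of a different mode. -/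
theorem Aop_comm_of_add_ne_zero {a b : ℤ} (ha : 0 < a) (hb : b < 0) (hab : a + b ≠ 0)
    (p : FockSpace) : Aop a (Aop b p) = Aop b (Aop a p) := by
  obtain ⟨n, rfl⟩ := exists_pnat_cast_eq ha
  obtain ⟨k, hk⟩ := exists_pnat_cast_eq (neg_pos.mpr hb)
  obtain rfl : b = -((k : ℕ) : ℤ) := by omega
  have : k ≠ n := by rintro rfl; exact hab (by simp)
  rw [Aop_neg_natCast, Aop_neg_natCast, map_smul, Aop_natCast, Aop_natCast, Derivation.leibniz,
    pderiv_X_of_ne this]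
  simp

theorem Aop_neg_one (p : FockSpace) : Aop (-1) p = (-Complex.I) • (X 1 * p) := by
  simpa using Aop_neg_natCast 1 p

theorem Aop_neg_two (p : FockSpace) : Aop (-2) p = (-Complex.I * 2) • (X 2 * p) := by
  simpa using Aop_neg_natCast 2 p

theorem Aop_one_X_one : Aop 1 (X 1 : FockSpace) = (Complex.I / 2) • (1 : FockSpace) := by
  simpa using Aop_natCast 1 (X 1)

theorem smul_neg_I_smul (c d : ℂ) (p : FockSpace) :
    (Complex.I * c) • (-Complex.I * d) • p = (c * d) • p := by
  rw [smul_smul]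
  congr 1
  linear_combination (-c * d) * Complex.I_mul_I

theorem Lop_of_ne_zero (Q : ℝ) (α : ℂ) {n : ℤ} (hn : n ≠ 0) (p : FockSpace) :
    Lop Q α n p = (Complex.I * (α - ((n : ℂ) + 1) * (Q : ℂ))) • Aop n p +
      ∑ᶠ m : ℤ, if m = 0 ∨ m = n then 0 else Aop (n - m) (Aop m p) := by
  rw [Lop, if_neg hn]

theorem Lop_neg_one_one (Q : ℝ) (α : ℂ) : Lop Q α (-1) (1 : FockSpace) = α • X 1 := by
  have hs : ∀ m : ℤ, (if m = 0 ∨ m = -1 then 0 else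
      Aop (-1 - m) (Aop m (1 : FockSpace))) = 0 := by
    intro m
    split_ifs with h
    · rfl
    · rcases lt_trichotomy m 0 with hm | hm | hm
      · rw [Aop_comm_of_add_ne_zero (by omega) hm (by omega), Aop_one_of_pos (by omega), map_zero]
      · omega
      · rw [Aop_one_of_pos hm, map_zero]
  rw [Lop_of_ne_zero _ _ (by norm_num), finsum_congr hs, finsum_zero, Aop_neg_one]
  simpa using smul_neg_I_smul α 1 (X 1)

theorem Lop_neg_one_X_one (Q : ℝ) (α : ℂ) :
    Lop Q α (-1) (X 1 : FockSpace) = α • (X 1 * X 1) + (2 : ℂ) • X 2 := by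
  have hs : Function.support (fun m : ℤ => if m = 0 ∨ m = -1 then 0 else
      Aop (-1 - m) (Aop m (X 1 : FockSpace))) ⊆ (({1, -2} : Finset ℤ) : Set ℤ) := by
    intro m
    contrapose!
    intro hm'
    have h₁ : m ≠ 1 ∧ m ≠ -2 := by simpa using hm'
    rw [Function.notMem_support]
    split_ifs with h
    · rfl
    · rcases lt_trichotomy m 0 with hm | hm | hm
      · rw [Aop_comm_of_add_ne_zero (by omega) hm (by omega),
          Aop_X_of_ne (by omega) (by simp; omega), map_zero]
      · omega
      · rw [Aop_X_of_ne hm (by simp; omega), map_zero]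
  have hX : Aop (-2) (Aop 1 (X 1 : FockSpace)) = X 2 := by
    rw [Aop_one_X_one, Aop_neg_two, mul_smul_comm, mul_one, smul_smul]
    have : -Complex.I * 2 * (Complex.I / 2) = 1 := by linear_combination -Complex.I_mul_I
    rw [this, one_smul]
  have hX' : Aop 1 (Aop (-2) (X 1 : FockSpace)) = X 2 := by
    rw [Aop_comm_of_add_ne_zero (by norm_num) (by norm_num) (by norm_num), hX]
  have hc := smul_neg_I_smul α 1 (X 1 * X 1)
  simp only [mul_one] at hc
  rw [Lop_of_ne_zero _ _ (by norm_num), finsum_eq_sum_of_support_subset _ hs,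
    Finset.sum_pair (by norm_num)]
  norm_num [hX, hX', Aop_neg_one, two_smul]
  simpa using hc

theorem Lop_neg_two_one (Q : ℝ) (α : ℂ) :
    Lop Q α (-2) (1 : FockSpace) = (2 * (α + Q)) • X 2 - X 1 * X 1 := by
  have hs : ∀ m : ℤ, m ≠ -1 → (if m = 0 ∨ m = -2 then 0 else
      Aop (-2 - m) (Aop m (1 : FockSpace))) = 0 := by
    intro m h₁
    split_ifs with h
    · rfl
    · rcases lt_trichotomy m 0 with hm | hm | hm
      · rw [Aop_comm_of_add_ne_zero (by omega) hm (by omega), Aop_one_of_pos (by omega), map_zero]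
      · omega
      · rw [Aop_one_of_pos hm, map_zero]
  have hX : Aop (-1) (Aop (-1) (1 : FockSpace)) = -(X 1 * X 1) := by
    simp [Aop_neg_one, smul_smul]
  have hc : Complex.I * (α - (((-2 : ℤ) : ℂ) + 1) * Q) = Complex.I * (α + Q) := by
    push_cast
    ring
  rw [Lop_of_ne_zero _ _ (by norm_num), finsum_eq_single _ _ hs, if_neg (by norm_num), hc,
    Aop_neg_two, smul_neg_I_smul, mul_one, show (-2 - -1 : ℤ) = -1 by norm_num, hX,
    mul_comm (α + (Q : ℂ)), sub_eq_add_neg]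

theorem Lop_neg_one_smul_X_one (Q : ℝ) (α c : ℂ) :
    Lop Q α (-1) (c • X 1 : FockSpace) = c • Lop Q α (-1) (X 1 : FockSpace) := by
  simp [Lop, smul_finsum, smul_comm c]

theorem levelTwoSingular_eq (Q : ℝ) (α : ℂ) :
    levelTwoSingular Q α = (2 * α * (α ^ 2 + Q * α + 1)) • X 2 := by
  rw [levelTwoSingular, Lop_neg_one_one, Lop_neg_one_smul_X_one, Lop_neg_one_X_one,
    Lop_neg_two_one]
  module

/-- the level-two singular vector and the Kac table. For all `α ∈ ℂ`,
`(α²·L_{-2}^{0,α} + (L_{-1}^{0,α})²) 1 = 2α(α² + Qα + 1)·φ_2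
 = 2α(α - α_{1,2})(α - α_{2,1})·φ_2` with `α_{1,2} = -2/γ`, `α_{2,1} = -γ/2`;
it vanishes iff `α ∈ {0, -γ/2, -2/γ}`, and it is nonzero at the dual weights
`2Q - α_{1,2}` and `2Q - α_{2,1}`. -/
theorem level_two_singular_vector (γ : ℝ) (hγ0 : 0 < γ) (hγ2 : γ < 2) :
    (∀ α : ℂ,
      levelTwoSingular (γ / 2 + 2 / γ) α =
        (2 * α * (α ^ 2 + ((γ / 2 + 2 / γ : ℝ) : ℂ) * α + 1)) • MvPolynomial.X (2 : ℕ+) ∧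
      levelTwoSingular (γ / 2 + 2 / γ) α =
        (2 * α * (α - ((-(2 / γ) : ℝ) : ℂ)) * (α - ((-(γ / 2) : ℝ) : ℂ))) •
          MvPolynomial.X (2 : ℕ+) ∧
      (levelTwoSingular (γ / 2 + 2 / γ) α = 0 ↔
        α = 0 ∨ α = ((-(γ / 2) : ℝ) : ℂ) ∨ α = ((-(2 / γ) : ℝ) : ℂ))) ∧
    levelTwoSingular (γ / 2 + 2 / γ) ((2 * (γ / 2 + 2 / γ) - (-(2 / γ)) : ℝ) : ℂ) ≠ 0 ∧
    levelTwoSingular (γ / 2 + 2 / γ) ((2 * (γ / 2 + 2 / γ) - (-(γ / 2)) : ℝ) : ℂ) ≠ 0 := by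
  have hγ : (γ : ℂ) ≠ 0 := by exact_mod_cast hγ0.ne'
  have key : ∀ α : ℂ, levelTwoSingular (γ / 2 + 2 / γ) α =
      (2 * α * (α - ((-(2 / γ) : ℝ) : ℂ)) * (α - ((-(γ / 2) : ℝ) : ℂ))) • X (2 : ℕ+) := by
    intro α
    rw [levelTwoSingular_eq]
    congr 1
    push_cast
    field_simp
    ring
  have zero_iff : ∀ α : ℂ, levelTwoSingular (γ / 2 + 2 / γ) α = 0 ↔
      α = 0 ∨ α = ((-(γ / 2) : ℝ) : ℂ) ∨ α = ((-(2 / γ) : ℝ) : ℂ) := by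
    intro α
    rw [key, smul_eq_zero_iff_left (X_ne_zero _), mul_eq_zero, mul_eq_zero, sub_eq_zero,
      sub_eq_zero, mul_eq_zero_iff_left two_ne_zero]
    tauto
  have ne_zero_of_pos : ∀ x : ℝ, 0 < x → levelTwoSingular (γ / 2 + 2 / γ) (x : ℂ) ≠ 0 := by
    intro x hx h
    have h₁ : 0 < γ / 2 := by positivity
    have h₂ : 0 < 2 / γ := by positivity
    rcases (zero_iff x).mp h with h | h | h
    · exact hx.ne' (by exact_mod_cast h)
    · have := Complex.ofReal_injective h
      linarith
    · have := Complex.ofReal_injective h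
      linarith
  have h₁ : 0 < γ / 2 := by positivity
  have h₂ : 0 < 2 / γ := by positivity
  exact ⟨fun α => ⟨levelTwoSingular_eq _ α, key α, zero_iff α⟩,
    ne_zero_of_pos _ (by linarith), ne_zero_of_pos _ (by linarith)⟩
end
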